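/- Let G be a dense, K_4^3 ∪ e-free 3-graph with λ(G) > √3/18. Then G contains at least two copies of K_4^3; that is, there exist two distinct 4-element subsets of V(G) each of which spans a complete 3-graph (all four of its triples are edges of G). -/

import Mathlib

open Finset

/-- An `r`-uniform hypergraph (r-graph) with vertices drawn from `ℕ`. -/
structure HyperGraph (r : ℕ) where
  verts : Finset ℕ
  edges : Finset (Finset ℕ)
  edges_sub : ∀ e ∈ edges, e ⊆ verts
  card_eq : ∀ e ∈ edges, e.card = r

/-- A 3-uniform hypergraph (3-graph). -/
abbrev ThreeGraph := HyperGraph 3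

/-- A feasible weight vector on `G`: nonnegative weights on the vertices summing to 1. -/
def HyperGraph.IsFeasible {r : ℕ} (G : HyperGraph r) (w : ℕ → ℝ) : Prop :=
  (∀ v ∈ G.verts, 0 ≤ w v) ∧ ∑ v ∈ G.verts, w v = 1

/-- The Lagrangian function `λ(G, w) = Σ_{e ∈ E(G)} Π_{v ∈ e} w v`. -/
noncomputable def HyperGraph.lagFun {r : ℕ} (G : HyperGraph r) (w : ℕ → ℝ) : ℝ :=
  ∑ e ∈ G.edges, ∏ v ∈ e, w v

/-- The Lagrangian `λ(G)`: the maximum of `λ(G, w)` over feasible weight vectors. -/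
noncomputable def HyperGraph.lag {r : ℕ} (G : HyperGraph r) : ℝ :=
  sSup {x : ℝ | ∃ w, G.IsFeasible w ∧ G.lagFun w = x}

/-- `G` contains a copy of `F`: an injection of the vertices of `F` into those of `G`
mapping every edge of `F` to an edge of `G`. -/
def HyperGraph.ContainsCopy {r : ℕ} (G F : HyperGraph r) : Prop :=
  ∃ f : ℕ → ℕ, Set.InjOn f ↑F.verts ∧ (∀ v ∈ F.verts, f v ∈ G.verts) ∧
    ∀ e ∈ F.edges, e.image f ∈ G.edges

/-- `G` is `F`-free. -/
def HyperGraph.Free {r : ℕ} (G F : HyperGraph r) : Prop := ¬ G.ContainsCopy F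

/-- `H` is a subgraph of `G`. -/
def HyperGraph.IsSubgraph {r : ℕ} (H G : HyperGraph r) : Prop :=
  H.verts ⊆ G.verts ∧ H.edges ⊆ G.edges

/-- `G` is dense: every proper subgraph has strictly smaller Lagrangian. -/
def HyperGraph.LagDense {r : ℕ} (G : HyperGraph r) : Prop :=
  ∀ H : HyperGraph r, H.IsSubgraph G → (H.verts ≠ G.verts ∨ H.edges ≠ G.edges) →
    H.lag < G.lag

/-- The Lagrangian density `π_λ(F) = sup { r! · λ(G) : G is F-free }`. -/
noncomputable def lagDensity {r : ℕ} (F : HyperGraph r) : ℝ :=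
  sSup {x : ℝ | ∃ G : HyperGraph r, G.Free F ∧ x = (Nat.factorial r : ℝ) * G.lag}

/-- An optimum weight vector for `G`. -/
def HyperGraph.IsOptimal {r : ℕ} (G : HyperGraph r) (w : ℕ → ℝ) : Prop :=
  G.IsFeasible w ∧ G.lagFun w = G.lag

/-- `K_4^3 ∪ e`: the disjoint union of the complete 3-graph on `{1,2,3,4}`
and the single edge `{5,6,7}`. -/
def K43e : ThreeGraph where
  verts := {1, 2, 3, 4, 5, 6, 7}
  edges := {{1, 2, 3}, {1, 2, 4}, {1, 3, 4}, {2, 3, 4}, {5, 6, 7}}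
  edges_sub := by decide
  card_eq := by decide


/-! ### The `K_4`-free case: a sum-of-squares certificate on five vertices -/

/-- Value of a Boolean as an integer. -/
def bz (b : Bool) : ℤ := if b then 1 else 0

def flagPhi (q0 q1 q2 q3 : ℤ) (b0 b1 b2 : Bool) : ℤ :=
  match b0, b1, b2 with
  | false, false, false => q0
  | true, false, false => q1
  | false, true, false => q1
  | false, false, true => q1
  | true, true, false => q2
  | true, false, true => q2
  | false, true, true => q2
  | true, true, true => q3

/-- Sign-carrying flag function: compares the first two of three coordinates. -/
def flagDiff (b0 b1 b2 : Bool) : ℤ :=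
  match b0, b1, b2 with
  | true, false, false => 55
  | false, true, false => -55
  | false, true, true => -41
  | true, false, true => 41
  | _, _, _ => 0

/-- The linear forms whose squares are summed. -/
def flagForm (k : Fin 5) (t b0 b1 b2 : Bool) : ℤ :=
  match k, t with
  | 0, false => flagPhi 75 42 8 (-75) b0 b1 b2
  | 1, false => flagPhi 0 66 (-67) 57 b0 b1 b2
  | 2, true => flagDiff b0 b1 b2
  | 3, true => flagDiff b1 b2 b0
  | 4, true => flagDiff b2 b0 b1
  | _, _ => 0

def flagVal (t b0 b1 b2 c0 c1 c2 : Bool) : ℤ :=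
  10000 * bz t + (flagForm 0 t b0 b1 b2 * flagForm 0 t c0 c1 c2 +
    flagForm 1 t b0 b1 b2 * flagForm 1 t c0 c1 c2 +
    flagForm 2 t b0 b1 b2 * flagForm 2 t c0 c1 c2 +
    flagForm 3 t b0 b1 b2 * flagForm 3 t c0 c1 c2 +
    flagForm 4 t b0 b1 b2 * flagForm 4 t c0 c1 c2)

theorem flag_check : ∀ abc abd abe acd ace ade bcd bce bde cde : Bool,
    (abc && abd && acd && bcd) = false → (abc && abe && ace && bce) = false →
    (abd && abe && ade && bde) = false → (acd && ace && ade && cde) = false →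
    (bcd && bce && bde && cde) = false →
    flagVal abc bcd acd abd bce ace abe + flagVal abd bcd acd abc bde ade abe +
    flagVal acd bcd abd abc cde ade ace + flagVal bcd acd abd abc cde bde bce +
    flagVal abe bce ace abc bde ade abd + flagVal ace bce abe abc cde ade acd +
    flagVal bce ace abe abc cde bde bcd + flagVal ade bde abe abd cde ace acd +
    flagVal bde ade abe abd cde bce bcd + flagVal cde ade ace acd bde bce bcd ≤ 57730 := by
  decide +kernel

section
variable (V : Finset ℕ) (w : ℕ → ℝ)

/-- Weighted sum over ordered 5-tuples. -/
noncomputable def S5 (f : ℕ → ℕ → ℕ → ℕ → ℕ → ℝ) : ℝ :=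
  ∑ a ∈ V, ∑ b ∈ V, ∑ c ∈ V, ∑ d ∈ V, ∑ e ∈ V, w a * w b * w c * w d * w e * f a b c d e

theorem S5_12 (f : ℕ → ℕ → ℕ → ℕ → ℕ → ℝ) :
    S5 V w (fun a b c d e => f b a c d e) = S5 V w f := by
  unfold S5
  rw [Finset.sum_comm]
  refine sum_congr rfl fun a _ => sum_congr rfl fun b _ => sum_congr rfl fun c _ =>
    sum_congr rfl fun d _ => sum_congr rfl fun e _ => by ring

theorem S5_23 (f : ℕ → ℕ → ℕ → ℕ → ℕ → ℝ) :
    S5 V w (fun a b c d e => f a c b d e) = S5 V w f := by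
  unfold S5
  refine sum_congr rfl fun a _ => ?_
  rw [Finset.sum_comm]
  refine sum_congr rfl fun b _ => sum_congr rfl fun c _ =>
    sum_congr rfl fun d _ => sum_congr rfl fun e _ => by ring

theorem S5_34 (f : ℕ → ℕ → ℕ → ℕ → ℕ → ℝ) :
    S5 V w (fun a b c d e => f a b d c e) = S5 V w f := by
  unfold S5
  refine sum_congr rfl fun a _ => sum_congr rfl fun b _ => ?_
  rw [Finset.sum_comm]
  refine sum_congr rfl fun c _ =>
    sum_congr rfl fun d _ => sum_congr rfl fun e _ => by ring

theorem S5_45 (f : ℕ → ℕ → ℕ → ℕ → ℕ → ℝ) :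
    S5 V w (fun a b c d e => f a b c e d) = S5 V w f := by
  unfold S5
  refine sum_congr rfl fun a _ => sum_congr rfl fun b _ => sum_congr rfl fun c _ => ?_
  rw [Finset.sum_comm]
  refine sum_congr rfl fun d _ => sum_congr rfl fun e _ => by ring

theorem S5_add (f g : ℕ → ℕ → ℕ → ℕ → ℕ → ℝ) :
    S5 V w (fun a b c d e => f a b c d e + g a b c d e) = S5 V w f + S5 V w g := by
  unfold S5
  simp only [mul_add, sum_add_distrib]

theorem S5_mono (hw : ∀ v ∈ V, 0 ≤ w v) (f g : ℕ → ℕ → ℕ → ℕ → ℕ → ℝ)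
    (h : ∀ a b c d e, f a b c d e ≤ g a b c d e) : S5 V w f ≤ S5 V w g := by
  unfold S5
  refine sum_le_sum fun a ha => sum_le_sum fun b hb => sum_le_sum fun c hc =>
    sum_le_sum fun d hd => sum_le_sum fun e he => mul_le_mul_of_nonneg_left (h a b c d e) ?_
  have := hw a ha; have := hw b hb; have := hw c hc; have := hw d hd; have := hw e he
  positivity

theorem S5_const (h1 : ∑ v ∈ V, w v = 1) (f : ℕ → ℕ → ℕ → ℝ) :
    S5 V w (fun a b c _ _ => f a b c) =
      ∑ a ∈ V, ∑ b ∈ V, ∑ c ∈ V, w a * w b * w c * f a b c := by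
  unfold S5
  refine sum_congr rfl fun a _ => sum_congr rfl fun b _ => sum_congr rfl fun c _ => ?_
  have : ∀ d e, w a * w b * w c * w d * w e * f a b c = (w a * w b * w c * f a b c) * (w d * w e) :=
    fun d e => by ring
  simp only [this, ← mul_sum, h1, mul_one]

theorem S5_sq (hw : ∀ v ∈ V, 0 ≤ w v) (f : ℕ → ℕ → ℕ → ℕ → ℝ) :
    0 ≤ S5 V w (fun a b c d e => f a b c d * f a b c e) := by
  unfold S5
  refine sum_nonneg fun a ha => sum_nonneg fun b hb => sum_nonneg fun c hc => ?_
  have h : ∑ d ∈ V, ∑ e ∈ V, w a * w b * w c * w d * w e * (f a b c d * f a b c e) =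
      w a * w b * w c * (∑ d ∈ V, w d * f a b c d) ^ 2 := by
    rw [sq, sum_mul_sum, mul_sum]
    refine sum_congr rfl fun d _ => ?_
    rw [mul_sum]
    refine sum_congr rfl fun e _ => by ring
  rw [h]
  have := hw a ha; have := hw b hb; have := hw c hc
  positivity

variable (E : ℕ → ℕ → ℕ → Bool)

def gV (a b c x y : ℕ) : ℝ :=
  ((flagVal (E a b c) (E b c x) (E a c x) (E a b x) (E b c y) (E a c y) (E a b y) : ℤ) : ℝ)

theorem K4free_bound (hw : ∀ v ∈ V, 0 ≤ w v) (h1 : ∑ v ∈ V, w v = 1)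
    (s1 : ∀ a b c, E b a c = E a b c) (s2 : ∀ a b c, E a c b = E a b c)
    (hK : ∀ a b c d, (E a b c && E a b d && E a c d && E b c d) = false) :
    ∑ a ∈ V, ∑ b ∈ V, ∑ c ∈ V, w a * w b * w c * (bz (E a b c) : ℝ) ≤ 0.5773 := by
  -- lower bound
  have hlow : 10000 * ∑ a ∈ V, ∑ b ∈ V, ∑ c ∈ V, w a * w b * w c * (bz (E a b c) : ℝ) ≤
      S5 V w (gV E) := by
    have e1 : S5 V w (gV E) = S5 V w (fun a b c d e => (10000 * (bz (E a b c) : ℝ)) + 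
      (((((flagForm 0 (E a b c) (E b c d) (E a c d) (E a b d) : ℝ) * 
          (flagForm 0 (E a b c) (E b c e) (E a c e) (E a b e) : ℝ)) +
       ((flagForm 1 (E a b c) (E b c d) (E a c d) (E a b d) : ℝ) * 
          (flagForm 1 (E a b c) (E b c e) (E a c e) (E a b e) : ℝ))) +
       ((flagForm 2 (E a b c) (E b c d) (E a c d) (E a b d) : ℝ) * 
          (flagForm 2 (E a b c) (E b c e) (E a c e) (E a b e) : ℝ))) +
       ((flagForm 3 (E a b c) (E b c d) (E a c d) (E a b d) : ℝ) * 
          (flagForm 3 (E a b c) (E b c e) (E a c e) (E a b e) : ℝ)) +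
       ((flagForm 4 (E a b c) (E b c d) (E a c d) (E a b d) : ℝ) * 
          (flagForm 4 (E a b c) (E b c e) (E a c e) (E a b e) : ℝ)))) := by
      congr 1
      funext a b c d e
      unfold gV flagVal
      push_cast
      ring
    have hs := fun k : Fin 5 => S5_sq V w hw
      (fun a b c d => (flagForm k (E a b c) (E b c d) (E a c d) (E a b d) : ℝ))
    rw [e1, S5_add, S5_add, S5_add, S5_add, S5_add,
      S5_const V w h1 (fun a b c => 10000 * (bz (E a b c) : ℝ))]
    have e2 : ∑ a ∈ V, ∑ b ∈ V, ∑ c ∈ V, w a * w b * w c * (10000 * (bz (E a b c) : ℝ)) =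
      10000 * ∑ a ∈ V, ∑ b ∈ V, ∑ c ∈ V, w a * w b * w c * (bz (E a b c) : ℝ) := by
      simp only [mul_sum]
      refine sum_congr rfl fun a _ => sum_congr rfl fun b _ => sum_congr rfl fun c _ => by ring
    rw [e2]
    have := hs 0; have := hs 1; have := hs 2; have := hs 3; have := hs 4
    linarith
  -- the ten splits
  have p2 : S5 V w (fun a b c d e => gV E a b d c e) = S5 V w (gV E) := S5_34 V w (gV E)
  have p3 : S5 V w (fun a b c d e => gV E a c d b e) = S5 V w (gV E) := by
    rw [← p2]; exact S5_23 V w (fun a b c d e => gV E a b d c e)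
  have p4 : S5 V w (fun a b c d e => gV E b c d a e) = S5 V w (gV E) := by
    rw [← p3]; exact S5_12 V w (fun a b c d e => gV E a c d b e)
  have q1 : S5 V w (fun a b c d e => gV E a b e c d) = S5 V w (gV E) := by
    rw [← p2]; exact S5_45 V w (fun a b c d e => gV E a b d c e)
  have q2 : S5 V w (fun a b c d e => gV E a c e b d) = S5 V w (gV E) := by
    rw [← q1]; exact S5_23 V w (fun a b c d e => gV E a b e c d)
  have q3 : S5 V w (fun a b c d e => gV E b c e a d) = S5 V w (gV E) := by
    rw [← q2]; exact S5_12 V w (fun a b c d e => gV E a c e b d)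
  have q4 : S5 V w (fun a b c d e => gV E a d e b c) = S5 V w (gV E) := by
    rw [← q2]; exact S5_34 V w (fun a b c d e => gV E a c e b d)
  have q5 : S5 V w (fun a b c d e => gV E b d e a c) = S5 V w (gV E) := by
    rw [← q4]; exact S5_12 V w (fun a b c d e => gV E a d e b c)
  have q6 : S5 V w (fun a b c d e => gV E c d e a b) = S5 V w (gV E) := by
    rw [← q5]; exact S5_23 V w (fun a b c d e => gV E b d e a c)
  have hup : S5 V w (fun a b c d e => gV E a b c d e + gV E a b d c e + gV E a c d b e +
      gV E b c d a e + gV E a b e c d + gV E a c e b d + gV E b c e a d + gV E a d e b c +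
      gV E b d e a c + gV E c d e a b) ≤ S5 V w (fun _ _ _ _ _ => 57730) := by
    refine S5_mono V w hw _ _ fun a b c d e => ?_
    have key := flag_check (E a b c) (E a b d) (E a b e) (E a c d) (E a c e) (E a d e)
      (E b c d) (E b c e) (E b d e) (E c d e) (hK a b c d) (hK a b c e) (hK a b d e)
      (hK a c d e) (hK b c d e)
    have r : ∀ x y z, E y z x = E x y z := fun x y z => by rw [s2, s1]
    have key' := (Int.cast_le (R := ℝ)).2 key
    push_cast at key'
    unfold gV
    rw [s2 a c d, s2 b c d, s2 a b c, s2 a b d, s2 a b e, r b c d, r a c d, r a b c, r a b d,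
      r a b e, s2 b c e, s2 a c e, s2 b d e, s2 a d e, r b c e, s2 c d e, r a c e, r b d e,
      r c d e, r a d e]
    exact key'
  rw [S5_const V w h1 (fun _ _ _ => 57730)] at hup
  have e3 : ∑ a ∈ V, ∑ b ∈ V, ∑ c ∈ V, w a * w b * w c * (57730 : ℝ) = 57730 := by
    simp only [← sum_mul, ← mul_sum, h1, mul_one, one_mul]
  rw [e3] at hup
  simp only [S5_add] at hup
  rw [p2, p3, p4, q1, q2, q3, q4, q5, q6] at hup
  have : S5 V w (fun a b c d e => gV E a b c d e) = S5 V w (gV E) := rfl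
  rw [this] at hup
  norm_num
  linarith
end

/-! ### The case of exactly one `K_4` -/

theorem bz_nonneg (b : Bool) : (0 : ℝ) ≤ (bz b : ℝ) := by cases b <;> simp [bz]
theorem bz_le_one (b : Bool) : (bz b : ℝ) ≤ 1 := by cases b <;> simp [bz]

set_option maxHeartbeats 2000000 in
theorem trianglefree_four (x1 x2 x3 x4 : ℝ) (h1 : 0 ≤ x1) (h2 : 0 ≤ x2) (h3 : 0 ≤ x3)
    (h4 : 0 ≤ x4) (a b c d e f : Bool)
    (t1 : (a && b && d) = false) (t2 : (a && c && e) = false)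
    (t3 : (b && c && f) = false) (t4 : (d && e && f) = false) :
    2 * (x1 * x2 * (bz a : ℝ) + x1 * x3 * (bz b : ℝ) + x1 * x4 * (bz c : ℝ) +
      x2 * x3 * (bz d : ℝ) + x2 * x4 * (bz e : ℝ) + x3 * x4 * (bz f : ℝ)) ≤
      (x1 + x2 + x3 + x4) ^ 2 / 2 := by
  have m12 := mul_nonneg h1 h2
  have m13 := mul_nonneg h1 h3
  have m14 := mul_nonneg h1 h4
  have m23 := mul_nonneg h2 h3
  have m24 := mul_nonneg h2 h4
  have m34 := mul_nonneg h3 h4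
  have q1 := sq_nonneg (x1 + x2 - x3 - x4)
  have q2 := sq_nonneg (x1 + x3 - x2 - x4)
  have q3 := sq_nonneg (x1 + x4 - x2 - x3)
  have q4 := sq_nonneg (x1 - x2 - x3 - x4)
  have q5 := sq_nonneg (x2 - x1 - x3 - x4)
  have q6 := sq_nonneg (x3 - x1 - x2 - x4)
  have q7 := sq_nonneg (x4 - x1 - x2 - x3)
  cases a <;> cases b <;> cases c <;> cases d <;> cases e <;> cases f <;>
    simp [bz] at t1 t2 t3 t4 ⊢ <;> linarith

theorem final_ineq (s y W A : ℝ) (hs : 0 ≤ s) (hy : 0 ≤ y) (hsy : s + y = 1)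
    (hW : W ≤ s ^ 2 / 2 * y) (hA : A ≤ s * y ^ 2) (Q : ℝ) (hQ : s * A ≤ s ^ 2 * y ^ 2 - Q / 2)
    (hQ2 : 4 / 3 * s * W - s ^ 4 / 3 ≤ Q) : 3 / 8 * s ^ 3 + 3 * W + 3 * A ≤ 0.5773 := by
  obtain rfl : y = 1 - s := by linarith
  rcases le_or_gt s 0.7 with h | h
  · rcases hs.eq_or_lt with h0 | h0
    · subst h0; norm_num at *; linarith
    have h2 : s * (3 / 8 * s ^ 3 + 3 * W + 3 * A) ≤
        s * (7 / 8 * s ^ 3 + s ^ 2 * (1 - s) / 2 + 3 * s * (1 - s) ^ 2) := by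
      nlinarith [mul_le_mul_of_nonneg_left hW hs]
    have h3 := le_of_mul_le_mul_left h2 h0
    refine h3.trans ?_
    norm_num at h ⊢
    nlinarith [mul_nonneg hs (sub_nonneg.2 h), mul_nonneg (mul_nonneg hs hs) (sub_nonneg.2 h),
      mul_nonneg hs (sq_nonneg (s - 1/2)), mul_nonneg (sub_nonneg.2 h) (sq_nonneg (s - 1/2)),
      sq_nonneg (s - 1 / 2), sq_nonneg (s - 3/5)]
  · norm_num at h ⊢
    have : 3 / 8 * s ^ 3 + 3 * W + 3 * A ≤
      3 / 8 * s ^ 3 + 3 * (s ^ 2 / 2 * (1 - s)) + 3 * (s * (1 - s) ^ 2) := by linarith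
    refine this.trans ?_
    have hs1 : 0 ≤ s - 7 / 10 := by linarith
    nlinarith [mul_nonneg hs1 hy, mul_nonneg (mul_nonneg hs1 hy) hs1, 
       mul_nonneg (mul_nonneg hs1 hy) hy]

theorem pairs_four (a b c d : ℝ) :
    2 * (a * b + a * c + a * d + b * c + b * d + c * d) ≤ 3 / 4 * (a + b + c + d) ^ 2 := by
  nlinarith [sq_nonneg (a - b), sq_nonneg (a - c), sq_nonneg (a - d),
    sq_nonneg (b - c), sq_nonneg (b - d), sq_nonneg (c - d)]

set_option maxHeartbeats 2000000 in
theorem oneK4_bound (V : Finset ℕ) (w : ℕ → ℝ) (E : ℕ → ℕ → ℕ → Bool)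
    (hw : ∀ v ∈ V, 0 ≤ w v) (h1 : ∑ v ∈ V, w v = 1)
    (s1 : ∀ a b c, E b a c = E a b c) (s2 : ∀ a b c, E a c b = E a b c)
    (irr : ∀ a c, E a a c = false) (i1 i2 i3 i4 : ℕ) (S : Finset ℕ) (hSV : S ⊆ V)
    (hS : ∀ f : ℕ → ℝ, ∑ i ∈ S, f i = f i1 + f i2 + f i3 + f i4)
    (hi1 : i1 ∈ S) (hi2 : i2 ∈ S) (hi3 : i3 ∈ S) (hi4 : i4 ∈ S)
    (k123 : E i1 i2 i3 = true) (k124 : E i1 i2 i4 = true) (k134 : E i1 i3 i4 = true)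
    (k234 : E i2 i3 i4 = true)
    (hmeet : ∀ a b c, a ∉ S → b ∉ S → c ∉ S → E a b c = false)
    (hK : ∀ a b c d, d ∉ S → (E a b c && E a b d && E a c d && E b c d) = false) :
    ∑ a ∈ V, ∑ b ∈ V, ∑ c ∈ V, w a * w b * w c * (bz (E a b c) : ℝ) ≤ 0.5773 := by
  set Y := V \ S with hY
  have hV : ∀ f : ℕ → ℝ, ∑ a ∈ V, f a = ∑ a ∈ S, f a + ∑ a ∈ Y, f a := fun f => by
    rw [hY, add_comm, sum_sdiff hSV]
  have hYS : ∀ u ∈ Y, u ∉ S := fun u hu => (mem_sdiff.1 hu).2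
  have hwS : ∀ v ∈ S, 0 ≤ w v := fun v hv => hw v (hSV hv)
  have hwY : ∀ v ∈ Y, 0 ≤ w v := fun v hv => hw v (mem_sdiff.1 hv).1
  obtain ⟨s, hs⟩ : ∃ s, s = ∑ i ∈ S, w i := ⟨_, rfl⟩
  obtain ⟨y, hy⟩ : ∃ y, y = ∑ i ∈ Y, w i := ⟨_, rfl⟩
  have hs0 : 0 ≤ s := hs ▸ sum_nonneg hwS
  have hy0 : 0 ≤ y := hy ▸ sum_nonneg hwY
  have hsy : s + y = 1 := by rw [hs, hy, ← hV, h1]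
  let T : Finset ℕ → Finset ℕ → Finset ℕ → ℝ := fun A B C =>
    ∑ a ∈ A, ∑ b ∈ B, ∑ c ∈ C, w a * w b * w c * (bz (E a b c) : ℝ)
  have T12 : ∀ A B C, T A B C = T B A C := fun A B C => by
    simp only [T]
    rw [sum_comm]
    refine sum_congr rfl fun a _ => sum_congr rfl fun b _ => sum_congr rfl fun c _ => ?_
    rw [s1 a b c]; ring
  have T23 : ∀ A B C, T A B C = T A C B := fun A B C => by
    simp only [T]
    refine sum_congr rfl fun a _ => ?_
    rw [sum_comm]
    refine sum_congr rfl fun b _ => sum_congr rfl fun c _ => ?_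
    rw [s2 a b c]; ring
  have hsplit : T V V V = T S S S + 3 * T S S Y + 3 * T S Y Y + T Y Y Y := by
    have e : T V V V = T S S S + T S S Y + T S Y S + T S Y Y + T Y S S + T Y S Y + T Y Y S
        + T Y Y Y := by
      simp only [T, hV, sum_add_distrib]; ring
    rw [e, T23 S Y S, T12 Y S S, T23 S Y S, T12 Y S Y, T23 Y Y S, T12 Y S Y]; ring
  have hYYY : T Y Y Y = 0 := by
    refine sum_eq_zero fun a ha => sum_eq_zero fun b hb => sum_eq_zero fun c hc => ?_
    rw [hmeet a b c (hYS a ha) (hYS b hb) (hYS c hc)]; simp [bz]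
  have irr2 : ∀ a c, E c a a = false := fun a c => by rw [← s1, s2, irr]
  have irr3 : ∀ a c, E a c a = false := fun a c => by rw [s2, irr]
  have x1 := hwS i1 hi1
  have x2 := hwS i2 hi2
  have x3 := hwS i3 hi3
  have x4 := hwS i4 hi4
  have hs' : s = w i1 + w i2 + w i3 + w i4 := by rw [hs, hS]
  have hSSS : T S S S ≤ 3 / 8 * s ^ 3 := by
    have e : T S S S ≤ 6 * (w i1 * w i2 * w i3 + w i1 * w i2 * w i4 + w i1 * w i3 * w i4 +
        w i2 * w i3 * w i4) := by
      have e1 : T S S S = 6 * (w i1 * w i2 * w i3 * (bz (E i1 i2 i3) : ℝ)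
          + w i1 * w i2 * w i4 * (bz (E i1 i2 i4) : ℝ) + w i1 * w i3 * w i4 * (bz (E i1 i3 i4) : ℝ)
          + w i2 * w i3 * w i4 * (bz (E i2 i3 i4) : ℝ)) := by
        have r : ∀ x y z, E y z x = E x y z := fun x y z => by rw [s2, s1]
        have rcyc : ∀ x y z, E z x y = E x y z := fun x y z => by rw [s1, s2]
        have rrev : ∀ x y z, E z y x = E x y z := fun x y z => by rw [s1, s2, s1]
        simp only [T, hS, irr, irr2, irr3]
        rw [s1 i1 i2 i3, s2 i1 i2 i3, r i1 i2 i3, rcyc i1 i2 i3, rrev i1 i2 i3,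
          s1 i1 i2 i4, s2 i1 i2 i4, r i1 i2 i4, rcyc i1 i2 i4, rrev i1 i2 i4,
          s1 i1 i3 i4, s2 i1 i3 i4, r i1 i3 i4, rcyc i1 i3 i4, rrev i1 i3 i4,
          s1 i2 i3 i4, s2 i2 i3 i4, r i2 i3 i4, rcyc i2 i3 i4, rrev i2 i3 i4]
        simp only [bz]
        push_cast
        ring
      rw [e1]
      have := mul_le_of_le_one_right (mul_nonneg (mul_nonneg x1 x2) x3) (bz_le_one (E i1 i2 i3))
      have := mul_le_of_le_one_right (mul_nonneg (mul_nonneg x1 x2) x4) (bz_le_one (E i1 i2 i4))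
      have := mul_le_of_le_one_right (mul_nonneg (mul_nonneg x1 x3) x4) (bz_le_one (E i1 i3 i4))
      have := mul_le_of_le_one_right (mul_nonneg (mul_nonneg x2 x3) x4) (bz_le_one (E i2 i3 i4))
      linarith
    refine e.trans ?_
    rw [hs']
    nlinarith [mul_nonneg (add_nonneg x3 x4) (sq_nonneg (w i1 - w i2)),
      mul_nonneg (add_nonneg x1 x2) (sq_nonneg (w i3 - w i4)),
      mul_nonneg (add_nonneg (add_nonneg x1 x2) (add_nonneg x3 x4))
        (sq_nonneg (w i1 + w i2 - w i3 - w i4))]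
  have hlink : ∀ u ∈ Y, ∑ i ∈ S, ∑ j ∈ S, w i * w j * (bz (E i j u) : ℝ) ≤ s ^ 2 / 2 := by
    intro u hu
    have hu' := hYS u hu
    have := trianglefree_four (w i1) (w i2) (w i3) (w i4) x1 x2 x3 x4
      (E i1 i2 u) (E i1 i3 u) (E i1 i4 u) (E i2 i3 u) (E i2 i4 u) (E i3 i4 u)
      (by simpa [k123] using hK i1 i2 i3 u hu') (by simpa [k124] using hK i1 i2 i4 u hu')
      (by simpa [k134] using hK i1 i3 i4 u hu') (by simpa [k234] using hK i2 i3 i4 u hu')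
    rw [hs']
    refine le_trans (le_of_eq ?_) this
    simp only [hS, irr]
    rw [s1 i1 i2, s1 i1 i3, s1 i1 i4, s1 i2 i3, s1 i2 i4, s1 i3 i4]
    simp only [bz]
    push_cast
    ring
  -- the weight of edges with two vertices in `S`
  have hW : T S S Y = ∑ u ∈ Y, w u * ∑ i ∈ S, ∑ j ∈ S, w i * w j * (bz (E i j u) : ℝ) := by
    simp only [T, mul_sum]
    rw [sum_comm (s := Y)]
    refine sum_congr rfl fun i _ => ?_
    rw [sum_comm (s := Y)]
    exact sum_congr rfl fun j _ => sum_congr rfl fun u _ => by ring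
  have hWle : T S S Y ≤ s ^ 2 / 2 * y := by
    rw [hW, hy, mul_sum]
    refine sum_le_sum fun u hu => ?_
    rw [mul_comm]
    exact mul_le_mul_of_nonneg_right (hlink u hu) (hwY u hu)
  -- the weight of edges with one vertex in `S`
  let al : ℕ → ℕ → ℝ := fun u v => ∑ i ∈ S, w i * (bz (E i u v) : ℝ)
  let M : ℕ → ℕ → ℝ := fun u v => ∑ i ∈ S, ∑ j ∈ S,
    w i * w j * ((bz (E i j u) : ℝ) * (bz (E i j v) : ℝ))
  have hA : T S Y Y = ∑ u ∈ Y, ∑ v ∈ Y, w u * w v * al u v := by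
    simp only [T, al, mul_sum]
    rw [sum_comm]
    refine sum_congr rfl fun u _ => ?_
    rw [sum_comm]
    refine sum_congr rfl fun v _ => sum_congr rfl fun i _ => by ring
  have hal0 : ∀ u v, 0 ≤ al u v := fun u v =>
    sum_nonneg fun i hi => mul_nonneg (hwS i hi) (bz_nonneg _)
  have hals : ∀ u v, al u v ≤ s := fun u v => by
    rw [hs]
    exact sum_le_sum fun i hi => mul_le_of_le_one_right (hwS i hi) (bz_le_one _)
  have hyy : ∀ c : ℝ, ∑ u ∈ Y, ∑ v ∈ Y, w u * w v * c = y ^ 2 * c := fun c => by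
    simp only [← sum_mul, ← mul_sum, ← hy]; ring
  have hAle : T S Y Y ≤ s * y ^ 2 := by
    rw [hA, mul_comm, ← hyy]
    exact sum_le_sum fun u hu => sum_le_sum fun v hv =>
      mul_le_mul_of_nonneg_left (hals u v) (mul_nonneg (hwY u hu) (hwY v hv))
  have hM : ∀ u ∈ Y, ∀ v ∈ Y, M u v ≤ s ^ 2 - al u v ^ 2 := by
    intro u hu v hv
    have e1 : s ^ 2 = ∑ i ∈ S, ∑ j ∈ S, w i * w j := by rw [sq, hs, sum_mul_sum]
    have e2 : al u v ^ 2 =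
        ∑ i ∈ S, ∑ j ∈ S, w i * w j * ((bz (E i u v) : ℝ) * (bz (E j u v) : ℝ)) := by
      simp only [al]
      rw [sq, sum_mul_sum]
      exact sum_congr rfl fun i _ => sum_congr rfl fun j _ => by ring
    rw [e1, e2, ← sum_sub_distrib]
    refine sum_le_sum fun i hi => ?_
    rw [← sum_sub_distrib]
    refine sum_le_sum fun j hj => ?_
    have hk := hK i j u v (hYS v hv)
    have : (bz (E i j u) : ℝ) * (bz (E i j v) : ℝ) ≤
        1 - (bz (E i u v) : ℝ) * (bz (E j u v) : ℝ) := by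
      revert hk
      cases E i j u <;> cases E i j v <;> cases E i u v <;> cases E j u v <;> simp [bz]
    nlinarith [mul_le_mul_of_nonneg_left this (mul_nonneg (hwS i hi) (hwS j hj))]
  have hQ : s * T S Y Y ≤ s ^ 2 * y ^ 2 - (∑ u ∈ Y, ∑ v ∈ Y, w u * w v * M u v) / 2 := by
    have e : s ^ 2 * y ^ 2 - (∑ u ∈ Y, ∑ v ∈ Y, w u * w v * M u v) / 2 =
        ∑ u ∈ Y, ∑ v ∈ Y, w u * w v * (s ^ 2 - M u v / 2) := by
      have := hyy (s ^ 2)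
      simp only [mul_sub, sum_sub_distrib]
      rw [this, mul_comm (s ^ 2), sum_div]
      congr 1
      refine sum_congr rfl fun u _ => ?_
      rw [sum_div]
      exact sum_congr rfl fun v _ => by ring
    rw [e, hA, mul_sum]
    refine sum_le_sum fun u hu => ?_
    rw [mul_sum]
    refine sum_le_sum fun v hv => ?_
    have h3 : s * al u v ≤ s ^ 2 - M u v / 2 := by
      nlinarith [hM u hu v hv, sq_nonneg (s - al u v)]
    nlinarith [mul_le_mul_of_nonneg_left h3 (mul_nonneg (hwY u hu) (hwY v hv))]
  let p : ℕ → ℕ → ℝ := fun i j => ∑ u ∈ Y, w u * (bz (E i j u) : ℝ)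
  have hQp : ∑ u ∈ Y, ∑ v ∈ Y, w u * w v * M u v =
      ∑ i ∈ S, ∑ j ∈ S, w i * w j * p i j ^ 2 := by
    have e : ∀ i j, w i * w j * p i j ^ 2 = ∑ u ∈ Y, ∑ v ∈ Y,
        w u * w v * (w i * w j * ((bz (E i j u) : ℝ) * (bz (E i j v) : ℝ))) := fun i j => by
      simp only [p]
      rw [sq, sum_mul_sum, mul_sum]
      refine sum_congr rfl fun u _ => ?_
      rw [mul_sum]
      exact sum_congr rfl fun v _ => by ring
    simp only [e, M, hS]
    simp only [mul_add, sum_add_distrib]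
  have hWp : T S S Y = ∑ i ∈ S, ∑ j ∈ S, w i * w j * p i j := by
    simp only [T, p, mul_sum]
    exact sum_congr rfl fun i _ => sum_congr rfl fun j _ => sum_congr rfl fun u _ => by ring
  have hp0 : ∀ i, p i i = 0 := fun i => by simp [p, irr, bz]
  have hp1 : ∀ i j, p j i = p i j := fun i j => by simp only [p, s1 i j]
  have hQ2 : 4 / 3 * s * T S S Y - s ^ 4 / 3 ≤ ∑ u ∈ Y, ∑ v ∈ Y, w u * w v * M u v := by
    rw [hQp, hWp]
    simp only [hS, hp0]
    rw [hp1 i1 i2, hp1 i1 i3, hp1 i1 i4, hp1 i2 i3, hp1 i2 i4, hp1 i3 i4]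
    have g : ∀ a b t : ℝ, 0 ≤ a → 0 ≤ b →
        a * b * (4 / 3 * s * t) - a * b * (4 / 9 * s ^ 2) ≤ a * b * t ^ 2 := fun a b t ha hb => by
      nlinarith [mul_nonneg (mul_nonneg ha hb) (sq_nonneg (t - 2 / 3 * s))]
    have g12 := g _ _ (p i1 i2) x1 x2
    have g13 := g _ _ (p i1 i3) x1 x3
    have g14 := g _ _ (p i1 i4) x1 x4
    have g23 := g _ _ (p i2 i3) x2 x3
    have g24 := g _ _ (p i2 i4) x2 x4
    have g34 := g _ _ (p i3 i4) x3 x4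
    have h6 : 2 * (w i1 * w i2 + w i1 * w i3 + w i1 * w i4 + w i2 * w i3 + w i2 * w i4 +
        w i3 * w i4) ≤ 3 / 4 * s ^ 2 := by
      rw [hs']
      exact pairs_four _ _ _ _
    have h7 := mul_le_mul_of_nonneg_right h6 (by positivity : 0 ≤ 4 / 9 * s ^ 2)
    linarith
  have hfin := final_ineq s y (T S S Y) (T S Y Y) hs0 hy0 hsy hWle hAle _ hQ hQ2
  change T V V V ≤ 0.5773
  rw [hsplit, hYYY]
  linarith

/-! ### Translation to ordered sums and the main theorem -/

/-- Indicator of being an edge, on ordered triples. -/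
def edgeB (G : ThreeGraph) (a b c : ℕ) : Bool := decide (({a, b, c} : Finset ℕ) ∈ G.edges)

theorem triple_distinct {a b c : ℕ} (h : ({a, b, c} : Finset ℕ).card = 3) :
    a ≠ b ∧ a ≠ c ∧ b ≠ c := by
  refine ⟨?_, ?_, ?_⟩
  · rintro rfl
    have : ({a, a, c} : Finset ℕ).card ≤ 2 := by simpa using Finset.card_le_two (a := a) (b := c)
    omega
  · rintro rfl
    have : ({a, b, a} : Finset ℕ) = {a, b} := by ext; simp; tauto
    have h2 := Finset.card_le_two (a := a) (b := b)
    rw [this] at h; omega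
  · rintro rfl
    have h2 := Finset.card_le_two (a := a) (b := b)
    simp at h
    omega

theorem triple_eq_iff {a b c : ℕ} {e : Finset ℕ} (he : e.card = 3) (ha : a ∈ e) (hb : b ∈ e)
    (hc : c ∈ e) : ({a, b, c} : Finset ℕ) = e ↔ (a ≠ b ∧ a ≠ c ∧ b ≠ c) := by
  constructor
  · intro h
    exact triple_distinct (h ▸ he)
  · rintro ⟨h1, h2, h3⟩
    refine Finset.eq_of_subset_of_card_le ?_ ?_
    · intro x hx
      simp at hx
      rcases hx with rfl | rfl | rfl <;> assumption
    · rw [he, Finset.card_eq_three.2 ⟨a, b, c, h1, h2, h3, rfl⟩]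

theorem sum_fiber (V : Finset ℕ) (w : ℕ → ℝ) (e : Finset ℕ) (he : e.card = 3) (heV : e ⊆ V) :
    ∑ a ∈ V, ∑ b ∈ V, ∑ c ∈ V, (if ({a, b, c} : Finset ℕ) = e then w a * w b * w c else 0) =
      6 * ∏ v ∈ e, w v := by
  have h1 : ∑ a ∈ V, ∑ b ∈ V, ∑ c ∈ V,
      (if ({a, b, c} : Finset ℕ) = e then w a * w b * w c else 0) =
      ∑ a ∈ e, ∑ b ∈ e, ∑ c ∈ e, (if (a ≠ b ∧ a ≠ c ∧ b ≠ c) then w a * w b * w c else 0) := by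
    symm
    have hz : ∀ a b c, (a ∉ e ∨ b ∉ e ∨ c ∉ e) →
        (if ({a, b, c} : Finset ℕ) = e then w a * w b * w c else 0) = 0 := by
      intro a b c h
      rw [if_neg]
      rintro rfl
      simp at h
    rw [← Finset.sum_subset heV (fun a _ ha => Finset.sum_eq_zero fun b _ =>
      Finset.sum_eq_zero fun c _ => hz a b c (Or.inl ha))]
    refine Finset.sum_congr rfl fun a ha => ?_
    rw [← Finset.sum_subset heV (fun b _ hb =>
      Finset.sum_eq_zero fun c _ => hz a b c (Or.inr (Or.inl hb)))]
    refine Finset.sum_congr rfl fun b hb => ?_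
    rw [← Finset.sum_subset heV (fun c _ hc => hz a b c (Or.inr (Or.inr hc)))]
    refine Finset.sum_congr rfl fun c hc => ?_
    simp only [triple_eq_iff he ha hb hc]
  rw [h1]
  obtain ⟨x, y, z, hxy, hxz, hyz, rfl⟩ := Finset.card_eq_three.1 he
  have hs : ∀ f : ℕ → ℝ, ∑ i ∈ ({x, y, z} : Finset ℕ), f i = f x + f y + f z := fun f => by
    rw [Finset.sum_insert (by simp [hxy, hxz]), Finset.sum_pair hyz]; ring
  rw [Finset.prod_insert (by simp [hxy, hxz]), Finset.prod_pair hyz]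
  simp only [hs]
  simp [hxy, hxz, hyz, hxy.symm, hxz.symm, hyz.symm]
  ring

theorem lagFun_eq (G : ThreeGraph) (w : ℕ → ℝ) :
    ∑ a ∈ G.verts, ∑ b ∈ G.verts, ∑ c ∈ G.verts, w a * w b * w c * (bz (edgeB G a b c) : ℝ) =
      6 * G.lagFun w := by
  have h : ∀ a b c, w a * w b * w c * (bz (edgeB G a b c) : ℝ) =
      ∑ e ∈ G.edges, (if ({a, b, c} : Finset ℕ) = e then w a * w b * w c else 0) := by
    intro a b c
    rw [Finset.sum_ite_eq]
    unfold edgeB bz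
    by_cases h : ({a, b, c} : Finset ℕ) ∈ G.edges <;> simp [h]
  simp only [h]
  unfold HyperGraph.lagFun
  rw [Finset.mul_sum]
  have h2 : ∑ a ∈ G.verts, ∑ b ∈ G.verts, ∑ c ∈ G.verts, ∑ e ∈ G.edges,
      (if ({a, b, c} : Finset ℕ) = e then w a * w b * w c else 0) =
      ∑ e ∈ G.edges, ∑ a ∈ G.verts, ∑ b ∈ G.verts, ∑ c ∈ G.verts,
      (if ({a, b, c} : Finset ℕ) = e then w a * w b * w c else 0) := by
    rw [Finset.sum_comm (s := G.edges)]
    refine Finset.sum_congr rfl fun a _ => ?_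
    rw [Finset.sum_comm (s := G.edges)]
    refine Finset.sum_congr rfl fun b _ => ?_
    rw [Finset.sum_comm (s := G.edges)]
  rw [h2]
  exact Finset.sum_congr rfl fun e he => sum_fiber _ w e (G.card_eq e he) (G.edges_sub e he)

theorem edgeB_swap1 (G : ThreeGraph) (a b c : ℕ) : edgeB G b a c = edgeB G a b c := by
  unfold edgeB
  rw [Finset.insert_comm]

theorem edgeB_swap2 (G : ThreeGraph) (a b c : ℕ) : edgeB G a c b = edgeB G a b c := by
  unfold edgeB
  rw [Finset.pair_comm]

theorem edgeB_irr (G : ThreeGraph) (a c : ℕ) : edgeB G a a c = false := by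
  unfold edgeB
  rw [decide_eq_false_iff_not]
  intro h
  exact (triple_distinct (G.card_eq _ h)).1 rfl

/-- Four vertices all of whose triples are edges span a copy of `K_4`. -/
theorem span_K4 (G : ThreeGraph) {a b c d : ℕ} (h1 : edgeB G a b c = true)
    (h2 : edgeB G a b d = true) (h3 : edgeB G a c d = true) (h4 : edgeB G b c d = true) :
    ({a, b, c, d} : Finset ℕ) ⊆ G.verts ∧ ({a, b, c, d} : Finset ℕ).card = 4 ∧
      (∀ e ⊆ ({a, b, c, d} : Finset ℕ), e.card = 3 → e ∈ G.edges) ∧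
      (a ≠ b ∧ a ≠ c ∧ a ≠ d ∧ b ≠ c ∧ b ≠ d ∧ c ≠ d) := by
  simp only [edgeB, decide_eq_true_eq] at h1 h2 h3 h4
  obtain ⟨hab, hac, hbc⟩ := triple_distinct (G.card_eq _ h1)
  obtain ⟨-, had, hbd⟩ := triple_distinct (G.card_eq _ h2)
  obtain ⟨-, -, hcd⟩ := triple_distinct (G.card_eq _ h3)
  have hcard : ({a, b, c, d} : Finset ℕ).card = 4 := by
    rw [Finset.card_insert_of_notMem (by simp [hab, hac, had]),
      Finset.card_eq_three.2 ⟨b, c, d, hbc, hbd, hcd, rfl⟩]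
  refine ⟨?_, hcard, ?_, hab, hac, had, hbc, hbd, hcd⟩
  · intro x hx
    simp only [Finset.mem_insert, Finset.mem_singleton] at hx
    rcases hx with rfl | rfl | rfl | rfl
    · exact G.edges_sub _ h1 (by simp)
    · exact G.edges_sub _ h1 (by simp)
    · exact G.edges_sub _ h1 (by simp)
    · exact G.edges_sub _ h2 (by simp)
  · intro e he he3
    have h5 : (({a, b, c, d} : Finset ℕ) \ e).card = 1 := by
      rw [Finset.card_sdiff_of_subset he, hcard, he3]
    obtain ⟨x, hx⟩ := Finset.card_eq_one.1 h5
    have h6 : e = ({a, b, c, d} : Finset ℕ) \ {x} := by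
      rw [← hx, Finset.sdiff_sdiff_eq_self he]
    have hxm : x ∈ ({a, b, c, d} : Finset ℕ) := by
      have : x ∈ ({a, b, c, d} : Finset ℕ) \ e := by rw [hx]; simp
      exact (Finset.mem_sdiff.1 this).1
    simp only [Finset.mem_insert, Finset.mem_singleton] at hxm
    rcases hxm with rfl | rfl | rfl | rfl
    · convert h4
      rw [h6]; ext v; simp; grind
    · convert h3
      rw [h6]; ext v; simp; grind
    · convert h2
      rw [h6]; ext v; simp; grind
    · convert h1
      rw [h6]; ext v; simp; grind

theorem edge_meets_K4 (G : ThreeGraph) (hfree : G.Free K43e) {a b c d : ℕ}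
    (h1 : edgeB G a b c = true) (h2 : edgeB G a b d = true) (h3 : edgeB G a c d = true)
    (h4 : edgeB G b c d = true) (x y z : ℕ) (hx : x ∉ ({a, b, c, d} : Finset ℕ))
    (hy : y ∉ ({a, b, c, d} : Finset ℕ)) (hz : z ∉ ({a, b, c, d} : Finset ℕ)) :
    edgeB G x y z = false := by
  by_contra hne
  rw [Bool.not_eq_false] at hne
  obtain ⟨hsub, -, -, hab, hac, had, hbc, hbd, hcd⟩ := span_K4 G h1 h2 h3 h4
  simp only [edgeB, decide_eq_true_eq] at h1 h2 h3 h4 hne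
  obtain ⟨hxy, hxz, hyz⟩ := triple_distinct (G.card_eq _ hne)
  have hsub2 := G.edges_sub _ hne
  simp only [Finset.mem_insert, Finset.mem_singleton, not_or] at hx hy hz
  obtain ⟨xa, xb, xc, xd⟩ := hx
  obtain ⟨ya, yb, yc, yd⟩ := hy
  obtain ⟨za, zb, zc, zd⟩ := hz
  apply hfree
  let f : ℕ → ℕ := fun n => if n = 1 then a else if n = 2 then b else if n = 3 then c else
    if n = 4 then d else if n = 5 then x else if n = 6 then y else z
  have f1 : f 1 = a := rfl
  have f2 : f 2 = b := rfl
  have f3 : f 3 = c := rfl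
  have f4 : f 4 = d := rfl
  have f5 : f 5 = x := rfl
  have f6 : f 6 = y := rfl
  have f7 : f 7 = z := rfl
  refine ⟨f, ?_, ?_, ?_⟩
  · intro u hu v hv huv
    simp only [K43e, Finset.coe_insert, Finset.coe_singleton, Set.mem_insert_iff,
      Set.mem_singleton_iff] at hu hv
    rcases hu with rfl | rfl | rfl | rfl | rfl | rfl | rfl <;>
    rcases hv with rfl | rfl | rfl | rfl | rfl | rfl | rfl <;>
    first
      | rfl
      | (exfalso
         simp only [f1, f2, f3, f4, f5, f6, f7] at huv
         first | exact absurd huv (by assumption) | exact absurd huv.symm (by assumption))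
  · intro v hv
    simp only [K43e, Finset.mem_insert, Finset.mem_singleton] at hv
    rcases hv with rfl | rfl | rfl | rfl | rfl | rfl | rfl
    · exact hsub (by simp [f1])
    · exact hsub (by simp [f2])
    · exact hsub (by simp [f3])
    · exact hsub (by simp [f4])
    · exact hsub2 (by simp [f5])
    · exact hsub2 (by simp [f6])
    · exact hsub2 (by simp [f7])
  · intro e he
    simp only [K43e, Finset.mem_insert, Finset.mem_singleton] at he
    rcases he with rfl | rfl | rfl | rfl | rfl <;>
    simp only [Finset.image_insert, Finset.image_singleton, f1, f2, f3, f4, f5, f6, f7] <;>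
    assumption

/-- A dense `K_4^3 ∪ e`-free 3-graph with Lagrangian greater than `√3/18` contains at
least two copies of `K_4^3`: two distinct 4-element subsets of the vertex set, each of
which spans a complete 3-graph. -/
theorem dense_K43e_free_two_K43 (G : ThreeGraph) (hdense : G.LagDense)
    (hfree : G.Free K43e) (hlag : Real.sqrt 3 / 18 < G.lag) :
    ∃ S T : Finset ℕ, S ⊆ G.verts ∧ T ⊆ G.verts ∧ S.card = 4 ∧ T.card = 4 ∧ S ≠ T ∧
      (∀ e ⊆ S, e.card = 3 → e ∈ G.edges) ∧ (∀ e ⊆ T, e.card = 3 → e ∈ G.edges) := by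
  by_contra hcon
  refine absurd hlag (not_lt.2 ?_)
  have hsqrt : (1.7319 : ℝ) ≤ Real.sqrt 3 := Real.le_sqrt_of_sq_le (by norm_num)
  refine Real.sSup_le ?_ (by positivity)
  rintro _ ⟨w, ⟨hw, hw1⟩, rfl⟩
  suffices h : ∑ a ∈ G.verts, ∑ b ∈ G.verts, ∑ c ∈ G.verts,
      w a * w b * w c * (bz (edgeB G a b c) : ℝ) ≤ 0.5773 by
    rw [lagFun_eq] at h
    norm_num at h hsqrt
    linarith
  by_cases hex : ∃ a b c d, edgeB G a b c = true ∧ edgeB G a b d = true ∧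
      edgeB G a c d = true ∧ edgeB G b c d = true
  · obtain ⟨a, b, c, d, h1, h2, h3, h4⟩ := hex
    obtain ⟨hsub, hcard, hall, hab, hac, had, hbc, hbd, hcd⟩ := span_K4 G h1 h2 h3 h4
    refine oneK4_bound G.verts w (edgeB G) hw hw1 (edgeB_swap1 G) (edgeB_swap2 G) (edgeB_irr G)
      a b c d {a, b, c, d} hsub ?_ (by simp) (by simp) (by simp) (by simp) h1 h2 h3 h4
      (edge_meets_K4 G hfree h1 h2 h3 h4) ?_
    · intro f
      rw [Finset.sum_insert (by simp [hab, hac, had]), Finset.sum_insert (by simp [hbc, hbd]),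
        Finset.sum_pair hcd]
      ring
    · intro p q r t ht
      by_contra hne
      simp only [Bool.not_eq_false, Bool.and_eq_true] at hne
      obtain ⟨⟨⟨g1, g2⟩, g3⟩, g4⟩ := hne
      obtain ⟨hsub', hcard', hall', -⟩ := span_K4 G g1 g2 g3 g4
      refine hcon ⟨{a, b, c, d}, {p, q, r, t}, hsub, hsub', hcard, hcard', ?_, hall, hall'⟩
      intro heq
      rw [heq] at ht
      simp at ht
  · refine K4free_bound G.verts w (edgeB G) hw hw1 (edgeB_swap1 G) (edgeB_swap2 G) ?_
    intro a b c d
    by_contra hne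
    simp only [Bool.not_eq_false, Bool.and_eq_true] at hne
    obtain ⟨⟨⟨g1, g2⟩, g3⟩, g4⟩ := hne
    exact hex ⟨a, b, c, d, g1, g2, g3, g4⟩
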